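/- Let F be a field and let Ω be a connected, eventually outward, finitely branching tree quiver. Then every FLEI representation of Ω over F is a finite direct sum of indecomposable subrepresentations, and given two such decompositions there is a bijection between the two sets of summands taking each summand to an isomorphic one; that is, the category of FLEI representations of Ω is Krull–Schmidt. -/

import Mathlib

/-- A quiver: a set of vertices, a set of arrows, with source and target maps. -/
structure Quiv : Type 1 where
  V : Type
  A : Type
  s : A → V
  t : A → V

/-- A representation of a quiver over a field `F`. -/
structure QRep (F : Type) [Field F] (Q : Quiv) : Type 1 where
  M : Q.V → Type
  [acg : ∀ i, AddCommGroup (M i)]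
  [mod : ∀ i, Module F (M i)]
  map : ∀ a : Q.A, M (Q.s a) →ₗ[F] M (Q.t a)

attribute [instance] QRep.acg QRep.mod

namespace QRep

variable {F : Type} [Field F] {Q : Quiv}

/-- A representation is nonzero if some vertex space has a nonzero vector. -/
def Nonzero (V : QRep F Q) : Prop := ∃ i, ∃ x : V.M i, x ≠ 0

/-- A morphism of representations. -/
structure Hom (V W : QRep F Q) : Type where
  app : ∀ i, V.M i →ₗ[F] W.M i
  comm : ∀ a : Q.A, (W.map a).comp (app (Q.s a)) = (app (Q.t a)).comp (V.map a)

/-- A morphism is an isomorphism iff it is bijective at each vertex. -/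
def Hom.IsIso {V W : QRep F Q} (f : Hom V W) : Prop := ∀ i, Function.Bijective (f.app i)

/-- Two representations are isomorphic. -/
def Iso (V W : QRep F Q) : Prop := ∃ f : Hom V W, f.IsIso

/-- The (external) direct sum of two representations. -/
def dsum (V W : QRep F Q) : QRep F Q where
  M i := V.M i × W.M i
  map a := (V.map a).prodMap (W.map a)

/-- A representation is indecomposable if it is nonzero and not isomorphic to a direct
sum of two nonzero representations. -/
def Indec (V : QRep F Q) : Prop :=
  V.Nonzero ∧ ∀ A B : QRep F Q, A.Nonzero → B.Nonzero → ¬ Iso V (dsum A B)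

/-- FLEI: locally finite-dimensional, and all but finitely many arrow maps are
isomorphisms. -/
def IsFLEI (V : QRep F Q) : Prop :=
  (∀ i, FiniteDimensional F (V.M i)) ∧ {a : Q.A | ¬ Function.Bijective (V.map a)}.Finite

end QRep

/-- A subrepresentation: a subspace at each vertex, stable under the arrow maps. -/
structure Subrep {F : Type} [Field F] {Q : Quiv} (V : QRep F Q) : Type where
  S : ∀ i, Submodule F (V.M i)
  stable : ∀ a : Q.A, ∀ x ∈ S (Q.s a), V.map a x ∈ S (Q.t a)

namespace Subrep

variable {F : Type} [Field F] {Q : Quiv} {V : QRep F Q}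

/-- A subrepresentation, viewed as a representation in its own right. -/
def toRep (W : Subrep V) : QRep F Q where
  M i := ↥(W.S i)
  map a := (V.map a).restrict (W.stable a)

/-- The quotient of a representation by a subrepresentation. -/
def quot (W : Subrep V) : QRep F Q where
  M i := V.M i ⧸ W.S i
  map a := Submodule.mapQ _ _ (V.map a) (fun x hx => W.stable a x hx)

end Subrep
/-- Adjacency in the underlying graph of a quiver. -/
def Quiv.Adj (Q : Quiv) (i j : Q.V) : Prop :=
  ∃ a : Q.A, (Q.s a = i ∧ Q.t a = j) ∨ (Q.s a = j ∧ Q.t a = i)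

/-- The underlying graph is connected. -/
def Quiv.Connected (Q : Quiv) : Prop :=
  ∀ i j : Q.V, Relation.ReflTransGen Q.Adj i j

/-- Source of an oriented edge-traversal (arrow plus direction of traversal). -/
def Quiv.esrc (Q : Quiv) (p : Q.A × Bool) : Q.V := if p.2 then Q.s p.1 else Q.t p.1

/-- Target of an oriented edge-traversal. -/
def Quiv.etgt (Q : Quiv) (p : Q.A × Bool) : Q.V := if p.2 then Q.t p.1 else Q.s p.1

/-- `e 0, …, e (n-1)` is a cycle: a closed walk of positive length in the underlying
graph traversing no edge twice. -/
def Quiv.IsCycle (Q : Quiv) (n : ℕ) (e : ℕ → Q.A × Bool) : Prop :=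
  0 < n ∧ (∀ k < n, Q.etgt (e k) = Q.esrc (e ((k + 1) % n))) ∧
    (∀ j < n, ∀ k < n, (e j).1 = (e k).1 → j = k)

/-- The quiver has no cycles in its underlying graph. -/
def Quiv.NoCycles (Q : Quiv) : Prop := ¬ ∃ (n : ℕ) (e : ℕ → Q.A × Bool), Q.IsCycle n e

/-- A tree quiver: connected underlying graph with no cycles. -/
def Quiv.IsTree (Q : Quiv) : Prop := Q.Connected ∧ Q.NoCycles
/-- A journey in a quiver: a finite or infinite sequence of pairwise distinct vertices
`vert 0, vert 1, …` (up to index `len`, which may be `⊤`), consecutive vertices being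
joined by an arrow (in either direction). -/
structure Journey (Q : Quiv) : Type where
  len : ℕ∞
  vert : ℕ → Q.V
  edge : ∀ k : ℕ, (k : ℕ∞) < len → Q.A
  inj : ∀ m n : ℕ, (m : ℕ∞) ≤ len → (n : ℕ∞) ≤ len → vert m = vert n → m = n
  adj : ∀ (k : ℕ) (h : (k : ℕ∞) < len),
    (Q.s (edge k h) = vert k ∧ Q.t (edge k h) = vert (k + 1)) ∨
    (Q.s (edge k h) = vert (k + 1) ∧ Q.t (edge k h) = vert k)

/-- A quiver is eventually outward if every journey contains only finitely many arrows
pointing towards the start of the journey. -/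
def Quiv.EventuallyOutward (Q : Quiv) : Prop :=
  ∀ j : Journey Q,
    {k : ℕ | ∃ h : (k : ℕ∞) < j.len,
      Q.s (j.edge k h) = j.vert (k + 1) ∧ Q.t (j.edge k h) = j.vert k}.Finite

/-- A quiver is finitely branching if it is a union of finitely many journeys. -/
def Quiv.FinitelyBranching (Q : Quiv) : Prop :=
  ∃ (n : ℕ) (js : Fin n → Journey Q),
    (∀ v : Q.V, ∃ (m : Fin n) (k : ℕ), (k : ℕ∞) ≤ (js m).len ∧ (js m).vert k = v) ∧
    (∀ a : Q.A, ∃ (m : Fin n) (k : ℕ) (h : (k : ℕ∞) < (js m).len), (js m).edge k h = a)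
/-- A family of subrepresentations is an internal direct sum decomposition if at each
vertex the subspaces are independent and sum to the whole space. -/
def IsDecomp {F : Type} [Field F] {Q : Quiv} {V : QRep F Q} {ι : Type}
    (W : ι → Subrep V) : Prop :=
  (∀ i : Q.V, ∀ j : ι, Disjoint ((W j).S i) (⨆ (k : ι) (_ : k ≠ j), (W k).S i)) ∧
  (∀ i : Q.V, (⨆ j : ι, (W j).S i) = ⊤)

section PrimitiveIdempotents

variable {R : Type*} [Ring R]

/-- A nonzero idempotent `e` is primitive if `0` and `e` are the only idempotents of `e * R * e`. -/
structure IsPrimitiveIdem (e : R) : Prop where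
  idem : e * e = e
  ne_zero : e ≠ 0
  eq_or_eq : ∀ p, p * p = p → e * p = p → p * e = p → p = 0 ∨ p = e

/-- `x` is a unit of the corner ring `e * R * e`. -/
def IsCornerUnit (e x : R) : Prop :=
  ∃ y, e * y = y ∧ y * e = y ∧ x * y = e ∧ y * x = e

/-- Equivalence of idempotents: the projective modules `e * R` and `f * R` are isomorphic. -/
def IdemEquiv (e f : R) : Prop :=
  ∃ a b, e * a = a ∧ a * f = a ∧ f * b = b ∧ b * e = b ∧ a * b = e ∧ b * a = f

theorem IdemEquiv.trans {e f g : R} (h₁ : IdemEquiv e f) (h₂ : IdemEquiv f g) :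
    IdemEquiv e g := by
  obtain ⟨a, b, ea, af, fb, be, ab, ba⟩ := h₁
  obtain ⟨c, d, fc, cg, gd, df, cd, dc⟩ := h₂
  refine ⟨a * c, d * b, ?_, ?_, ?_, ?_, ?_, ?_⟩
  · rw [← mul_assoc, ea]
  · rw [mul_assoc, cg]
  · rw [← mul_assoc, gd]
  · rw [mul_assoc, be]
  · rw [mul_assoc, ← mul_assoc c, cd, fb, ab]
  · rw [mul_assoc, ← mul_assoc b, ba, fc, dc]

theorem IdemEquiv.conj {e : R} (he : e * e = e) {u v : R} (hvu : v * u = 1) :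
    IdemEquiv (u * e * v) e := by
  have hvu' (z : R) : v * (u * z) = z := by rw [← mul_assoc, hvu, one_mul]
  have he' (z : R) : e * (e * z) = e * z := by rw [← mul_assoc, he]
  exact ⟨u * e, e * v, by simp [mul_assoc, hvu', he], by simp [mul_assoc, he],
    by simp [he'], by simp [mul_assoc, hvu', he'], by simp [mul_assoc, he'],
    by simp [mul_assoc, hvu', he]⟩

theorem IsPrimitiveIdem.conj {e : R} (he : IsPrimitiveIdem e) {u v : R} (huv : u * v = 1)
    (hvu : v * u = 1) : IsPrimitiveIdem (u * e * v) := by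
  have huv' (z : R) : u * (v * z) = z := by rw [← mul_assoc, huv, one_mul]
  have hvu' (z : R) : v * (u * z) = z := by rw [← mul_assoc, hvu, one_mul]
  have he' (z : R) : e * (e * z) = e * z := by rw [← mul_assoc, he.idem]
  refine ⟨by simp [mul_assoc, hvu', he'], fun h => he.ne_zero ?_, fun p hp h₁ h₂ => ?_⟩
  · have := congrArg (fun z => v * z * u) h
    simpa [mul_assoc, hvu', hvu] using this
  · have hp' (z : R) : p * (p * z) = p * z := by rw [← mul_assoc, hp]
    have key : p = u * (v * p * u) * v := by simp [mul_assoc, huv, huv']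
    rcases he.eq_or_eq (v * p * u) (by simp [mul_assoc, huv', hp'])
      (by simpa [mul_assoc, hvu'] using congrArg (fun z => v * z * u) h₁)
      (by simpa [mul_assoc, hvu, hvu'] using congrArg (fun z => v * z * u) h₂) with h | h
    · left; rw [key, h]; simp
    · right; rw [key, h]

/-- Fitting's lemma for elements of a finite-dimensional algebra. -/
theorem exists_pow_succ_mul_eq_pow (F : Type*) [Field F] [Algebra F R] [Module.Finite F R]
    (x : R) : ∃ (n : ℕ) (y : R), x ^ (n + 1) * y = x ^ n ∧
      ∀ z, Commute z x → Commute z y := by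
  let C := Algebra.adjoin F {x}
  let x' : C := ⟨x, Algebra.self_mem_adjoin_singleton F x⟩
  have : IsArtinianRing C := IsArtinianRing.of_finite F C
  obtain ⟨n, y, hy⟩ := IsArtinian.exists_pow_succ_smul_dvd x' (1 : C)
  refine ⟨n, y, ?_, fun z hz => Algebra.commute_of_mem_adjoin_singleton_of_commute y.2 hz⟩
  simpa [x'] using congrArg (Subtype.val) hy

theorem IsPrimitiveIdem.nilpotent_or_isCornerUnit (F : Type*) [Field F] [Algebra F R]
    [Module.Finite F R] {e x : R} (he : IsPrimitiveIdem e) (hex : e * x = x) (hxe : x * e = x) :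
    IsNilpotent x ∨ IsCornerUnit e x := by
  obtain ⟨n, y, hy, hc⟩ := exists_pow_succ_mul_eq_pow F x
  have hxy : Commute x y := hc x rfl
  have hey : Commute e y := hc e (by rw [Commute, SemiconjBy, hex, hxe])
  have hexn : Commute e (x ^ n) := Commute.pow_right (by rw [Commute, SemiconjBy, hex, hxe]) n
  have hpow : ∀ k, x ^ (n + k) * y ^ k = x ^ n := by
    intro k
    induction k with
    | zero => simp
    | succ k ih =>
      calc x ^ (n + (k + 1)) * y ^ (k + 1) = x ^ k * (x ^ (n + 1) * y) * y ^ k := by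
            rw [pow_succ' y, show n + (k + 1) = k + (n + 1) by omega, pow_add x k]
            simp only [mul_assoc]
        _ = x ^ n := by rw [hy, ← pow_add, add_comm k, ih]
  set q := x ^ n * y ^ n with hq
  have hqq : q * q = q := by
    calc q * q = x ^ n * x ^ n * y ^ n * y ^ n := by
          rw [hq, mul_assoc, ← mul_assoc (y ^ n), ← (hxy.pow_pow n n).eq]
          simp only [mul_assoc]
      _ = q := by rw [← pow_add, hpow]
  have heq : Commute e q := hexn.mul_right (hey.pow_right n)
  have hxq : x ^ n * q = x ^ n := by rw [hq, ← mul_assoc, ← pow_add, hpow]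
  rcases he.eq_or_eq (e * q) (by rw [mul_assoc, ← mul_assoc q, ← heq.eq, mul_assoc e q q, hqq,
      ← mul_assoc, he.idem]) (by rw [← mul_assoc, he.idem])
      (by rw [mul_assoc, ← heq.eq, ← mul_assoc, he.idem]) with h | h
  · left
    refine ⟨n + 1, ?_⟩
    calc x ^ (n + 1) = x * e * (x ^ n * q) := by rw [hxq, hxe, pow_succ']
      _ = x * x ^ n * (e * q) := by
        rw [mul_assoc x e, ← mul_assoc e, hexn.eq]; simp only [mul_assoc]
      _ = 0 := by rw [h, mul_zero]
  · right
    have hxy1 : x * (e * y) = e := by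
      have hxyq : x * y * q = q := by
        rw [hq, mul_assoc, ← mul_assoc y, ← (hxy.pow_left n).eq, ← mul_assoc, ← mul_assoc x,
          ← pow_succ', hy]
      calc x * (e * y) = x * (e * y) * q := by
            rw [hey.eq, mul_assoc x, mul_assoc y, h]
        _ = e * (x * (y * q)) := by
            rw [← mul_assoc x, hxe, ← mul_assoc e, hex, mul_assoc]
        _ = e := by rw [← mul_assoc x, hxyq, h]
    refine ⟨e * y, by rw [← mul_assoc, he.idem], ?_, hxy1, ?_⟩
    · rw [mul_assoc, ← hey.eq, ← mul_assoc, he.idem]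
    · rw [mul_assoc, ← hxy.eq, ← mul_assoc, hex]
      rw [← mul_assoc, hxe] at hxy1
      exact hxy1

theorem IsPrimitiveIdem.isCornerUnit_sub {e x : R} (he : IsPrimitiveIdem e) (hex : e * x = x)
    (hxe : x * e = x) (hx : IsNilpotent x) : IsCornerUnit e (e - x) := by
  obtain ⟨u, hu⟩ := hx.isUnit_one_sub
  have h₁ : (1 - x) * (↑u⁻¹ : R) = 1 := by rw [← hu]; simp
  have h₂ : (↑u⁻¹ : R) * (1 - x) = 1 := by rw [← hu]; simp
  have h₃ : e * (1 - x) = e - x := by rw [mul_sub, mul_one, hex]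
  have h₄ : (1 - x) * e = e - x := by rw [sub_mul, one_mul, hxe]
  have hcomm : e * (↑u⁻¹ : R) = ↑u⁻¹ * e := by
    calc e * (↑u⁻¹ : R) = ↑u⁻¹ * ((1 - x) * e) * ↑u⁻¹ := by rw [← mul_assoc, h₂, one_mul]
      _ = ↑u⁻¹ * e := by rw [h₄, ← h₃, mul_assoc, mul_assoc, h₁, mul_one]
  refine ⟨e * ↑u⁻¹, by rw [← mul_assoc, he.idem], by rw [mul_assoc, ← hcomm, ← mul_assoc, he.idem],
    ?_, ?_⟩
  · rw [← h₄, mul_assoc, ← mul_assoc e, he.idem, hcomm, ← mul_assoc, h₁, one_mul]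
  · rw [← h₃, hcomm, mul_assoc, ← mul_assoc e, he.idem, h₃, ← h₄, ← mul_assoc, h₂, one_mul]

/-- The corner ring of a primitive idempotent of a finite-dimensional algebra is local. -/
theorem IsPrimitiveIdem.isCornerUnit_or_of_add (F : Type*) [Field F] [Algebra F R]
    [Module.Finite F R] {e a b : R} (he : IsPrimitiveIdem e) (hea : e * a = a) (hae : a * e = a)
    (heb : e * b = b) (h : IsCornerUnit e (a + b)) :
    IsCornerUnit e a ∨ IsCornerUnit e b := by
  obtain ⟨u, heu, hue, hu₁, hu₂⟩ := h
  have hlift : ∀ c, e * c = c → IsCornerUnit e (u * c) → IsCornerUnit e c := by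
    rintro c hec ⟨w, hew, hwe, hw₁, hw₂⟩
    refine ⟨w * u, by rw [← mul_assoc, hew], by rw [mul_assoc, hue], ?_, by rw [mul_assoc, hw₂]⟩
    calc c * (w * u) = (a + b) * (u * c * w) * u := by
          rw [← mul_assoc (a + b), ← mul_assoc (a + b), hu₁, hec, mul_assoc]
      _ = e := by rw [hw₁, mul_assoc, heu, hu₁]
  have hsub : u * b = e - u * a := by rw [← hu₂, mul_add, add_sub_cancel_left]
  rcases he.nilpotent_or_isCornerUnit F (x := u * a) (by rw [← mul_assoc, heu])
    (by rw [mul_assoc, hae]) with h | h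
  · right
    refine hlift b heb ?_
    rw [hsub]
    exact he.isCornerUnit_sub (by rw [← mul_assoc, heu]) (by rw [mul_assoc, hae]) h
  · exact .inl (hlift a hea h)

theorem IsPrimitiveIdem.not_isCornerUnit_zero {e : R} (he : IsPrimitiveIdem e) :
    ¬ IsCornerUnit e 0 := by
  rintro ⟨y, -, -, h, -⟩
  exact he.ne_zero (by rw [← h, zero_mul])

theorem IsPrimitiveIdem.exists_isCornerUnit_of_sum (F : Type*) [Field F] [Algebra F R]
    [Module.Finite F R] {e : R} (he : IsPrimitiveIdem e) {ι : Type*} (s : Finset ι) (x : ι → R)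
    (hex : ∀ i, e * x i = x i) (hxe : ∀ i, x i * e = x i) (h : IsCornerUnit e (∑ i ∈ s, x i)) :
    ∃ i ∈ s, IsCornerUnit e (x i) := by
  classical
  induction s using Finset.induction_on with
  | empty => exact absurd (by simpa using h) he.not_isCornerUnit_zero
  | insert i s hi ih =>
    rw [Finset.sum_insert hi] at h
    rcases he.isCornerUnit_or_of_add F (hex i) (hxe i) (by simp [Finset.mul_sum, hex]) h with h | h
    · exact ⟨i, by simp, h⟩
    · obtain ⟨j, hj, hju⟩ := ih h
      exact ⟨j, by simp [hj], hju⟩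

/-- If `e * f * e` is invertible in the corner ring of `e`, then `e` and `f` are conjugate,
by a unit commuting with every element that commutes with `e` and `f`. -/
theorem IsPrimitiveIdem.exists_conj_eq {e f : R} (he : IsPrimitiveIdem e) (hf : IsPrimitiveIdem f)
    (h : IsCornerUnit e (e * f * e)) :
    ∃ u v : R, u * v = 1 ∧ v * u = 1 ∧ u * f * v = e ∧
      ∀ g, Commute g e → Commute g f → Commute g u := by
  obtain ⟨c, hec, hce, h₁, h₂⟩ := h
  replace h₁ : e * (f * c) = e := by rw [← mul_assoc, ← hec, ← mul_assoc, h₁]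
  replace h₂ : c * (f * e) = e := by rw [← mul_assoc, ← hce, mul_assoc c, mul_assoc c, h₂]
  have hff := hf.idem
  have hee := he.idem
  have hff' (z : R) : f * (f * z) = f * z := by rw [← mul_assoc, hff]
  have hee' (z : R) : e * (e * z) = e * z := by rw [← mul_assoc, hee]
  have hec' (z : R) : e * (c * z) = c * z := by rw [← mul_assoc, hec]
  have hce' (z : R) : c * (e * z) = c * z := by rw [← mul_assoc, hce]
  have h₂' (z : R) : c * (f * (e * z)) = e * z := by
    rw [← mul_assoc f, ← mul_assoc, h₂]
  have hcfc : c * (f * c) = c := by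
    calc c * (f * c) = c * (f * e) * c := by rw [mul_assoc, mul_assoc, hec]
      _ = c := by rw [h₂, hec]
  have hcfc' (z : R) : c * (f * (c * z)) = c * z := by
    rw [← mul_assoc f, ← mul_assoc, hcfc]
  have hfcf : f * (c * f) = f := by
    refine (hf.eq_or_eq (f * (c * f)) ?_ (hff' _) ?_).resolve_left fun h0 => he.ne_zero ?_
    · simp only [mul_assoc, hff', hcfc']
    · simp only [mul_assoc, hff]
    · calc e = e * (f * (c * f)) * c := by simp only [mul_assoc, hcfc, h₁]
        _ = 0 := by rw [h0, mul_zero, zero_mul]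
  refine ⟨(1 - e) * (1 - f) + e * f, f * c + (1 - c * f) * (1 - e), ?_, ?_, ?_, ?_⟩
  · simp only [mul_add, add_mul, mul_sub, sub_mul, mul_one, one_mul, mul_assoc,
      hee, hff', hec', h₁, h₂, hfcf]
    abel
  · simp only [mul_add, add_mul, mul_sub, sub_mul, mul_one, one_mul, mul_assoc,
      hff, hee, hee', hce, hce', h₂, h₂', hfcf]
    abel
  · simp only [mul_add, add_mul, mul_sub, sub_mul, mul_one, one_mul, mul_assoc,
      hff, hff', h₁, h₂, hfcf]
    abel
  · intro g hge hgf
    exact (((Commute.one_right g).sub_right hge).mul_right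
      ((Commute.one_right g).sub_right hgf)).add_right (hge.mul_right hgf)

theorem OrthogonalIdempotents.conj {ι : Type*} {f : ι → R} (hf : OrthogonalIdempotents f)
    {u v : R} (hvu : v * u = 1) : OrthogonalIdempotents fun i => u * f i * v := by
  have hvu' (z : R) : v * (u * z) = z := by rw [← mul_assoc, hvu, one_mul]
  refine ⟨fun i => ?_, fun i j hij => ?_⟩
  · have h (z : R) : f i * (f i * z) = f i * z := by rw [← mul_assoc, (hf.idem i).eq]
    simp [IsIdempotentElem, mul_assoc, hvu', h]
  · have h (z : R) : f i * (f j * z) = 0 := by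
      rw [← mul_assoc, show f i * f j = 0 from hf.ortho hij, zero_mul]
    simp [mul_assoc, hvu', h]

/-- Uniqueness of orthogonal decompositions into primitive idempotents in a finite-dimensional
algebra. -/
theorem exists_equiv_idemEquiv_of_sum_eq (F : Type*) [Field F] [Algebra F R] [Module.Finite F R]
    {n m : ℕ} {e : Fin n → R} {f : Fin m → R}
    (he : OrthogonalIdempotents e) (hep : ∀ i, IsPrimitiveIdem (e i))
    (hf : OrthogonalIdempotents f) (hfp : ∀ i, IsPrimitiveIdem (f i))
    (hsum : ∑ i, e i = ∑ i, f i) : ∃ σ : Fin n ≃ Fin m, ∀ i, IdemEquiv (e i) (f (σ i)) := by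
  induction n generalizing m with
  | zero =>
    cases m with
    | zero => exact ⟨Equiv.refl _, fun i => i.elim0⟩
    | succ m =>
      have := hf.mul_sum_of_mem (Finset.mem_univ 0)
      rw [← hsum] at this
      simp only [Finset.univ_eq_empty, Finset.sum_empty, mul_zero] at this
      exact absurd this.symm (hfp 0).ne_zero
  | succ n ih =>
    have h0 := hep 0
    have hcomm_e : ∀ i, Commute (∑ k, e k) (e i) := fun i => by
      rw [Commute, SemiconjBy, he.mul_sum_of_mem (Finset.mem_univ i), Finset.sum_mul,
        Finset.sum_eq_single i (fun k _ hk => he.ortho hk) (by simp), (he.idem i).eq]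
    have hcomm_f : ∀ i, Commute (∑ k, f k) (f i) := fun i => by
      rw [Commute, SemiconjBy, hf.mul_sum_of_mem (Finset.mem_univ i), Finset.sum_mul,
        Finset.sum_eq_single i (fun k _ hk => hf.ortho hk) (by simp), (hf.idem i).eq]
    obtain ⟨k, -, hk⟩ := h0.exists_isCornerUnit_of_sum F Finset.univ
      (fun k => e 0 * f k * e 0) (fun k => by simp only [← mul_assoc, h0.idem])
      (fun k => by simp only [mul_assoc, h0.idem]) (by
        rw [← Finset.sum_mul, ← Finset.mul_sum, ← hsum, he.mul_sum_of_mem (Finset.mem_univ 0),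
          h0.idem]
        exact ⟨e 0, h0.idem, h0.idem, h0.idem, h0.idem⟩)
    obtain ⟨u, v, huv, hvu, hconj, hcu⟩ := h0.exists_conj_eq (hfp k) hk
    have hgu := hcu _ (hcomm_e 0) (hsum ▸ hcomm_f k)
    obtain ⟨m, rfl⟩ : ∃ m', m = m' + 1 := ⟨m - 1, by have := k.pos; omega⟩
    have hf' := hf.conj hvu
    have hsum' : ∑ i, e i = ∑ i, u * f i * v := by
      rw [← Finset.sum_mul, ← Finset.mul_sum, ← hsum, ← hgu.eq, mul_assoc, huv, mul_one]
    rw [Fin.sum_univ_succ, Fin.sum_univ_succAbove _ k, hconj, add_right_inj] at hsum'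
    obtain ⟨σ, hσ⟩ := ih (he.embedding (Fin.succEmb n)) (fun i => hep _)
      (hf'.embedding (Fin.succAboveEmb k)) (fun i => (hfp _).conj huv hvu) hsum'
    refine ⟨((finSuccEquiv n).trans (Equiv.optionCongr σ)).trans (finSuccEquiv' k).symm,
      fun i => ?_⟩
    refine Fin.cases ?_ (fun i => ?_) i
    · have := IdemEquiv.conj (hfp k).idem hvu
      rw [hconj] at this
      simpa using this
    · have := (hσ i).trans (IdemEquiv.conj (hfp _).idem hvu)
      simpa using this

/-- In a finite-dimensional algebra every idempotent is a sum of orthogonal primitive ones. -/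
theorem exists_primitive_decomposition (F : Type*) [Field F] [Algebra F R] [Module.Finite F R]
    (e : R) (he : e * e = e) : ∃ (ι : Type) (_ : Fintype ι) (f : ι → R),
      OrthogonalIdempotents f ∧ (∀ i, IsPrimitiveIdem (f i)) ∧ ∑ i, f i = e := by
  induction hn : Module.finrank F (LinearMap.range (LinearMap.mulLeft F e))
    using Nat.strong_induction_on generalizing e with
  | _ n ih =>
    by_cases h0 : e = 0
    · exact ⟨Empty, inferInstance, Empty.elim, ⟨fun i => i.elim, fun i => i.elim⟩,
        fun i => i.elim, by simp [h0]⟩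
    by_cases hp : IsPrimitiveIdem e
    · exact ⟨Unit, inferInstance, fun _ => e, ⟨fun _ => he, fun i j h => (h rfl).elim⟩,
        fun _ => hp, by simp⟩
    obtain ⟨p, hpp, hep, hpe, hp0, hpne⟩ : ∃ p, p * p = p ∧ e * p = p ∧ p * e = p ∧
        p ≠ 0 ∧ p ≠ e := by
      by_contra! hcon
      exact hp ⟨he, h0, fun p h₁ h₂ h₃ => or_iff_not_imp_left.2 (hcon p h₁ h₂ h₃)⟩
    have hlt : ∀ q, e * q = q → q * e = q → q * q = q → q ≠ e →
        Module.finrank F (LinearMap.range (LinearMap.mulLeft F q)) < n := by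
      intro q heq hqe hqq hqne
      rw [← hn]
      refine Submodule.finrank_lt_finrank_of_lt (lt_of_le_of_ne ?_ fun h => hqne ?_)
      · rintro _ ⟨z, rfl⟩
        exact ⟨q * z, by simp [← mul_assoc, heq]⟩
      · obtain ⟨z, hz⟩ : e ∈ LinearMap.range (LinearMap.mulLeft F q) := h ▸ ⟨e, he⟩
        rw [LinearMap.mulLeft_apply] at hz
        rw [← hqe, ← hz, ← mul_assoc, hqq]
    have hqq : (e - p) * (e - p) = e - p := by
      simp [mul_sub, sub_mul, he, hep, hpe, hpp]
    obtain ⟨ι, _, f, hf, hfp, hfs⟩ := ih _ (hlt p hep hpe hpp hpne) p hpp rfl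
    obtain ⟨κ, _, g, hg, hgp, hgs⟩ := ih _ (hlt (e - p) (by rw [mul_sub, he, hep])
      (by rw [sub_mul, he, hpe]) hqq (by simpa using hp0)) (e - p) hqq rfl
    have hfl : ∀ i, f i * p = f i := fun i => by
      rw [← hfs, hf.mul_sum_of_mem (Finset.mem_univ i)]
    have hfr : ∀ i, p * f i = f i := fun i => by
      rw [← hfs, Finset.sum_mul, Finset.sum_eq_single i (fun k _ hk => hf.ortho hk) (by simp),
        (hf.idem i).eq]
    have hgl : ∀ i, g i * (e - p) = g i := fun i => by
      rw [← hgs, hg.mul_sum_of_mem (Finset.mem_univ i)]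
    have hgr : ∀ i, (e - p) * g i = g i := fun i => by
      rw [← hgs, Finset.sum_mul, Finset.sum_eq_single i (fun k _ hk => hg.ortho hk) (by simp),
        (hg.idem i).eq]
    have hpq : p * (e - p) = 0 := by rw [mul_sub, hpe, hpp, sub_self]
    have hqp : (e - p) * p = 0 := by rw [sub_mul, hep, hpp, sub_self]
    refine ⟨ι ⊕ κ, inferInstance, Sum.elim f g, ⟨?_, ?_⟩, ?_, ?_⟩
    · rintro (i | i)
      exacts [hf.idem i, hg.idem i]
    · rintro (i | i) (j | j) hij
      · exact hf.ortho (by simpa using hij)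
      · change f i * g j = 0
        rw [← hfl, ← hgr, mul_assoc, ← mul_assoc p, hpq, zero_mul, mul_zero]
      · change g i * f j = 0
        rw [← hgl, ← hfr, mul_assoc, ← mul_assoc (e - p), hqp, zero_mul, mul_zero]
      · exact hg.ortho (by simpa using hij)
    · rintro (i | i)
      exacts [hfp i, hgp i]
    · simp [hfs, hgs]

end PrimitiveIdempotents

namespace QRep

variable {F : Type} [Field F] {Q : Quiv} {V : QRep F Q}

/-- The algebra of endomorphisms of a representation. -/
def endAlg (V : QRep F Q) : Subalgebra F (∀ i, Module.End F (V.M i)) where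
  carrier := {φ | ∀ a, V.map a ∘ₗ φ (Q.s a) = φ (Q.t a) ∘ₗ V.map a}
  mul_mem' {φ ψ} hφ hψ a := by
    ext x
    have h₁ := LinearMap.congr_fun (hφ a) (ψ (Q.s a) x)
    have h₂ := LinearMap.congr_fun (hψ a) x
    simp only [LinearMap.comp_apply, Pi.mul_apply, Module.End.mul_apply] at *
    rw [h₁, h₂]
  add_mem' {φ ψ} hφ hψ a := by
    rw [Pi.add_apply, Pi.add_apply, LinearMap.comp_add, LinearMap.add_comp, hφ a, hψ a]
  algebraMap_mem' r a := by
    ext x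
    simp [Pi.algebraMap_apply, Module.algebraMap_end_apply]

theorem endAlg_map_apply (φ : V.endAlg) (a : Q.A) (x : V.M (Q.s a)) :
    V.map a (φ.1 _ x) = φ.1 _ (V.map a x) :=
  LinearMap.congr_fun (φ.2 a) x

theorem endAlg_ext {φ ψ : V.endAlg} (h : ∀ i x, φ.1 i x = ψ.1 i x) : φ = ψ :=
  Subtype.ext <| funext fun i => LinearMap.ext (h i)

theorem endAlg_mul_apply (φ ψ : V.endAlg) (i : Q.V) (x : V.M i) :
    (φ * ψ).1 i x = φ.1 i (ψ.1 i x) := rfl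

theorem endAlg_sub_apply (φ ψ : V.endAlg) (i : Q.V) (x : V.M i) :
    (φ - ψ).1 i x = φ.1 i x - ψ.1 i x := rfl

theorem endAlg_one_apply (i : Q.V) (x : V.M i) : (1 : V.endAlg).1 i x = x := rfl

theorem endAlg_sum_apply {ι : Type*} (s : Finset ι) (φ : ι → V.endAlg) (i : Q.V) (x : V.M i) :
    (∑ j ∈ s, φ j).1 i x = ∑ j ∈ s, (φ j).1 i x := by
  simp [AddSubmonoidClass.coe_finsetSum, Finset.sum_apply, LinearMap.sum_apply]

/-- Adjacency through an arrow acting bijectively on `V`. -/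
def BijAdj (V : QRep F Q) (i j : Q.V) : Prop :=
  ∃ a : Q.A, Function.Bijective (V.map a) ∧
    ((Q.s a = i ∧ Q.t a = j) ∨ (Q.s a = j ∧ Q.t a = i))

/-- In a connected quiver, removing the arrows on which an FLEI representation is not bijective
leaves finitely many components. -/
theorem IsFLEI.exists_finset_reflTransGen (hQ : Q.Connected) (hV : V.IsFLEI) :
    ∃ R : Finset Q.V, ∀ j, ∃ r ∈ R, Relation.ReflTransGen V.BijAdj r j := by
  classical
  rcases isEmpty_or_nonempty Q.V with _ | ⟨⟨v⟩⟩
  · exact ⟨∅, isEmptyElim⟩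
  let B := hV.2.toFinset
  refine ⟨insert v (B.image Q.s ∪ B.image Q.t), fun j => ?_⟩
  induction hQ v j with
  | refl => exact ⟨v, by simp, .refl⟩
  | @tail i j _ hij ih =>
    obtain ⟨r, hr, hri⟩ := ih
    obtain ⟨a, ha⟩ := hij
    by_cases hb : Function.Bijective (V.map a)
    · exact ⟨r, hr, hri.tail ⟨a, hb, ha⟩⟩
    · refine ⟨j, ?_, .refl⟩
      have haB : a ∈ B := by simpa [B] using hb
      rcases ha with ⟨-, rfl⟩ | ⟨rfl, -⟩
      · exact Finset.mem_insert_of_mem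
          (Finset.mem_union_right _ (Finset.mem_image_of_mem _ haB))
      · exact Finset.mem_insert_of_mem
          (Finset.mem_union_left _ (Finset.mem_image_of_mem _ haB))

theorem endAlg_eq_zero_of_bijAdj (φ : V.endAlg) {i j : Q.V} (hij : V.BijAdj i j)
    (hi : φ.1 i = 0) : φ.1 j = 0 := by
  obtain ⟨a, hb, ⟨rfl, rfl⟩ | ⟨rfl, rfl⟩⟩ := hij
  · ext x
    obtain ⟨y, rfl⟩ := hb.2 x
    rw [← endAlg_map_apply, hi]
    simp
  · ext x
    apply hb.1
    rw [endAlg_map_apply, hi]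
    simp

theorem IsFLEI.finite_endAlg (hQ : Q.Connected) (hV : V.IsFLEI) : Module.Finite F V.endAlg := by
  obtain ⟨R, hR⟩ := hV.exists_finset_reflTransGen hQ
  have := hV.1
  let res : V.endAlg →ₗ[F] ∀ r : R, Module.End F (V.M r) :=
    LinearMap.pi (fun r => LinearMap.proj (r : Q.V)) ∘ₗ V.endAlg.val.toLinearMap
  refine Module.Finite.of_injective res ((injective_iff_map_eq_zero res).2 fun φ hφ => ?_)
  refine Subtype.ext (funext fun j => ?_)
  obtain ⟨r, hr, hrj⟩ := hR j
  change φ.1 j = 0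
  induction hrj with
  | refl => exact congrFun hφ ⟨r, hr⟩
  | tail _ hij ih => exact endAlg_eq_zero_of_bijAdj φ hij ih

end QRep

namespace Subrep

variable {F : Type} [Field F] {Q : Quiv} {V : QRep F Q}

/-- `φ` projects `V` onto the subrepresentation `W`. -/
def IsProj (W : Subrep V) (φ : V.endAlg) : Prop :=
  ∀ i, LinearMap.IsProj (W.S i) (φ.1 i)

/-- The range of an endomorphism. -/
def range (φ : V.endAlg) : Subrep V where
  S i := LinearMap.range (φ.1 i)
  stable a := by
    rintro _ ⟨y, rfl⟩
    exact ⟨V.map a y, (QRep.endAlg_map_apply φ a y).symm⟩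

theorem isProj_range {e : V.endAlg} (he : e * e = e) : (range e).IsProj e := fun i =>
  ⟨fun x => ⟨x, rfl⟩, by rintro _ ⟨y, rfl⟩; rw [← QRep.endAlg_mul_apply, he]⟩

theorem range_toRep_nonzero {e : V.endAlg} (he : e ≠ 0) : (range e).toRep.Nonzero := by
  by_contra h
  refine he (QRep.endAlg_ext fun i x => ?_)
  by_contra hx
  exact h ⟨i, ⟨e.1 i x, x, rfl⟩, fun h0 => hx (congrArg Subtype.val h0)⟩

theorem IsProj.idem {W : Subrep V} {e : V.endAlg} (h : W.IsProj e) : e * e = e :=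
  QRep.endAlg_ext fun i x => (h i).map_id _ ((h i).map_mem x)

theorem IsProj.isPrimitiveIdem {W : Subrep V} {e : V.endAlg} (h : W.IsProj e)
    (hW : W.toRep.Indec) : IsPrimitiveIdem e := by
  refine ⟨h.idem, ?_, fun p hpp hep hpe => ?_⟩
  · rintro rfl
    obtain ⟨i, x, hx⟩ := hW.1
    exact hx (Subtype.ext ((h i).map_id x.1 x.2).symm)
  · by_contra! hcon
    refine hW.2 (range p).toRep (range (e - p)).toRep (range_toRep_nonzero hcon.1)
      (range_toRep_nonzero (sub_ne_zero.2 hcon.2.symm)) ?_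
    have hpp' (i) (x : V.M i) : p.1 i (p.1 i x) = p.1 i x := by rw [← QRep.endAlg_mul_apply, hpp]
    have hep' (i) (x : V.M i) : e.1 i (p.1 i x) = p.1 i x := by rw [← QRep.endAlg_mul_apply, hep]
    have hpe' (i) (x : V.M i) : p.1 i (e.1 i x) = p.1 i x := by rw [← QRep.endAlg_mul_apply, hpe]
    have hee' (i) (x : V.M i) : e.1 i (e.1 i x) = e.1 i x := by
      rw [← QRep.endAlg_mul_apply, h.idem]
    refine ⟨⟨fun i => LinearMap.prod
      ((p.1 i).rangeRestrict ∘ₗ (W.S i).subtype)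
      (((e - p).1 i).rangeRestrict ∘ₗ (W.S i).subtype), fun a => ?_⟩, fun i => ⟨?_, ?_⟩⟩
    · refine LinearMap.ext fun x => Prod.ext (Subtype.ext ?_) (Subtype.ext ?_)
      · exact QRep.endAlg_map_apply p a x.1
      · exact QRep.endAlg_map_apply (e - p) a x.1
    · refine (injective_iff_map_eq_zero _).2 fun x hx => Subtype.ext ?_
      have h₁ : p.1 i x.1 = 0 := congrArg (fun y => y.1.1) hx
      have h₂ : (e - p).1 i x.1 = 0 := congrArg (fun y => y.2.1) hx
      rw [QRep.endAlg_sub_apply, h₁, sub_zero, (h i).map_id _ x.2] at h₂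
      exact h₂
    · rintro ⟨⟨_, x, rfl⟩, ⟨_, y, rfl⟩⟩
      have hmem : p.1 i x + (e - p).1 i y ∈ W.S i := by
        rw [QRep.endAlg_sub_apply, ← hep', ← hep' i y, ← map_sub, ← map_add]
        exact (h i).map_mem _
      refine ⟨⟨_, hmem⟩, Prod.ext (Subtype.ext ?_) (Subtype.ext ?_)⟩
      · change p.1 i (p.1 i x + (e - p).1 i y) = p.1 i x
        simp [hpp', hpe']
      · change (e - p).1 i (p.1 i x + (e - p).1 i y) = (e - p).1 i y
        simp [hpp', hpe', hep', hee']

theorem IsProj.indec {W : Subrep V} {e : V.endAlg} (h : W.IsProj e)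
    (he : IsPrimitiveIdem e) : W.toRep.Indec := by
  refine ⟨?_, ?_⟩
  · by_contra hcon
    refine he.ne_zero (QRep.endAlg_ext fun i x => ?_)
    by_contra hx
    exact hcon ⟨i, ⟨e.1 i x, (h i).map_mem x⟩, fun h0 => hx (congrArg Subtype.val h0)⟩
  · rintro A B ⟨i, x, hx⟩ ⟨j, y, hy⟩ ⟨g, hg⟩
    let G (i) : W.S i ≃ₗ[F] (A.M i × B.M i) := LinearEquiv.ofBijective (g.app i) (hg i)
    let T (a) : W.S (Q.s a) →ₗ[F] W.S (Q.t a) := (V.map a).restrict (W.stable a)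
    let P (i) : W.S i →ₗ[F] W.S i :=
      (G i).symm.toLinearMap ∘ₗ LinearMap.inl F _ _ ∘ₗ LinearMap.fst F _ _ ∘ₗ (G i).toLinearMap
    let E (i) : V.M i →ₗ[F] W.S i := (e.1 i).codRestrict _ (h i).map_mem
    have hE (i) (w : W.S i) : E i w = w := Subtype.ext ((h i).map_id w w.2)
    have hGP (i) (w : W.S i) : G i (P i w) = ((G i w).1, 0) := (G i).apply_symm_apply _
    have hPP (i) (w : W.S i) : P i (P i w) = P i w := (G i).injective (by rw [hGP, hGP])
    have hcommG (a) (w : W.S (Q.s a)) :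
        G (Q.t a) (T a w) = (A.map a (G _ w).1, B.map a (G _ w).2) :=
      (LinearMap.congr_fun (g.comm a) w).symm
    have hcommP (a) (w : W.S (Q.s a)) : T a (P _ w) = P _ (T a w) :=
      (G _).injective (by rw [hGP, hcommG, hcommG, hGP, map_zero])
    let p : V.endAlg := ⟨fun i => (W.S i).subtype ∘ₗ P i ∘ₗ E i, fun a => by
      ext z
      have h₁ : T a (E _ z) = E _ (V.map a z) :=
        Subtype.ext (QRep.endAlg_map_apply e a z)
      have h₂ := hcommP a (E _ z)
      rw [h₁] at h₂
      exact congrArg Subtype.val h₂⟩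
    have hp (i) (w : W.S i) : p.1 i w = P i w := by
      change ((P i (E i w) : W.S i) : V.M i) = P i w
      rw [hE]
    have hpe (i) (z : V.M i) : p.1 i z = P i (E i z) := rfl
    have hpp : p * p = p := QRep.endAlg_ext fun i z => by
      rw [QRep.endAlg_mul_apply, hpe i z, hp, hPP]
    have hep : e * p = p := QRep.endAlg_ext fun i z => by
      rw [QRep.endAlg_mul_apply, hpe]
      exact (h i).map_id _ (Subtype.property _)
    have hpe' : p * e = p := QRep.endAlg_ext fun i z => by
      rw [QRep.endAlg_mul_apply, hpe, hpe]
      exact congrArg (fun w => (P i w : V.M i)) (hE i (E i z))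
    rcases he.eq_or_eq p hpp hep hpe' with h0 | h1
    · have h₁ : P i ((G i).symm (x, 0)) = 0 := Subtype.ext (by rw [← hp, h0]; rfl)
      have h₂ : P i ((G i).symm (x, 0)) = (G i).symm (x, 0) := (G i).injective (by simp [hGP])
      rw [h₂, LinearEquiv.map_eq_zero_iff] at h₁
      exact hx (congrArg Prod.fst h₁)
    · have h₁ : P j ((G j).symm (0, y)) = (G j).symm (0, y) :=
        Subtype.ext (by rw [← hp, h1]; exact (h j).map_id _ (Subtype.property _))
      have h₂ : P j ((G j).symm (0, y)) = 0 :=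
        (G j).injective (by simp only [hGP, LinearEquiv.apply_symm_apply, map_zero]; rfl)
      rw [h₂, eq_comm, LinearEquiv.map_eq_zero_iff] at h₁
      exact hy (congrArg Prod.snd h₁)

theorem IsProj.iso {W X : Subrep V} {e f : V.endAlg} (hW : W.IsProj e) (hX : X.IsProj f)
    (h : IdemEquiv e f) : QRep.Iso W.toRep X.toRep := by
  obtain ⟨a, b, hea, -, hfb, -, hab, hba⟩ := h
  have hb (i) (x : V.M i) : b.1 i x ∈ X.S i := by
    rw [← hfb, QRep.endAlg_mul_apply]
    exact (hX i).map_mem _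
  have ha (i) (x : V.M i) : a.1 i x ∈ W.S i := by
    rw [← hea, QRep.endAlg_mul_apply]
    exact (hW i).map_mem _
  refine ⟨⟨fun i => (b.1 i).restrict fun x _ => hb i x, fun c => ?_⟩, fun i => ?_⟩
  · exact LinearMap.ext fun x => Subtype.ext (QRep.endAlg_map_apply b c x.1)
  · refine Function.bijective_iff_has_inverse.2
      ⟨fun y => ⟨a.1 i y.1, ha i y.1⟩, fun x => Subtype.ext ?_, fun y => Subtype.ext ?_⟩
    · change a.1 i (b.1 i x.1) = x.1
      rw [← QRep.endAlg_mul_apply, hab, (hW i).map_id _ x.2]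
    · change b.1 i (a.1 i y.1) = y.1
      rw [← QRep.endAlg_mul_apply, hba, (hX i).map_id _ y.2]

end Subrep

section Decomp

variable {F : Type} [Field F] {Q : Quiv} {V : QRep F Q}

theorem IsDecomp.isCompl {ι : Type} {W : ι → Subrep V} (hW : IsDecomp W) (j : ι) (i : Q.V) :
    IsCompl ((W j).S i) (⨆ (k : ι) (_ : k ≠ j), (W k).S i) := by
  refine ⟨hW.1 i j, codisjoint_iff.2 (top_le_iff.1 ?_)⟩
  rw [← hW.2 i]
  refine iSup_le fun k => ?_
  by_cases hk : k = j
  · exact hk ▸ le_sup_left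
  · exact (le_iSup₂_of_le (f := fun k (_ : k ≠ j) => (W k).S i) k hk le_rfl).trans le_sup_right

theorem IsDecomp.linearMap_ext {ι : Type} {W : ι → Subrep V} (hW : IsDecomp W) {i : Q.V}
    {N : Type*} [AddCommGroup N] [Module F N] {g h : V.M i →ₗ[F] N}
    (H : ∀ k, ∀ x ∈ (W k).S i, g x = h x) : g = h := by
  rw [← LinearMap.eqLocus_eq_top, ← top_le_iff, ← hW.2 i]
  exact iSup_le H

/-- The projections of an internal direct sum decomposition. -/
theorem IsDecomp.exists_idempotents {ι : Type} [Fintype ι] {W : ι → Subrep V} (hW : IsDecomp W) :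
    ∃ e : ι → V.endAlg, CompleteOrthogonalIdempotents e ∧ ∀ j, (W j).IsProj (e j) := by
  let E (j : ι) (i : Q.V) : Module.End F (V.M i) := Submodule.projection _ _ (hW.isCompl j i)
  have hmem (j i x) : E j i x ∈ (W j).S i := Submodule.projection_apply_mem _ _
  have hid (j i) (x) (hx : x ∈ (W j).S i) : E j i x = x :=
    Submodule.projection_apply_of_mem_left _ hx
  have hzero (j k i) (hkj : k ≠ j) (x) (hx : x ∈ (W k).S i) : E j i x = 0 :=
    Submodule.projection_apply_of_mem_right _
      (le_iSup₂_of_le (f := fun k (_ : k ≠ j) => (W k).S i) k hkj le_rfl hx)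
  let e (j : ι) : V.endAlg := ⟨E j, fun a => hW.linearMap_ext fun k x hx => by
    simp only [LinearMap.comp_apply]
    by_cases hk : k = j
    · subst hk
      rw [hid _ _ _ hx, hid _ _ _ ((W k).stable a x hx)]
    · rw [hzero _ _ _ hk _ hx, hzero _ _ _ hk _ ((W k).stable a x hx), map_zero]⟩
  have hproj (j) : (W j).IsProj (e j) := fun i => ⟨hmem j i, hid j i⟩
  refine ⟨e, ⟨⟨fun j => (hproj j).idem, fun j k hjk => QRep.endAlg_ext fun i x => ?_⟩, ?_⟩, hproj⟩
  · exact hzero j k i hjk.symm _ (hmem k i x)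
  · refine Subtype.ext (funext fun i => hW.linearMap_ext fun k x hx => ?_)
    rw [QRep.endAlg_sum_apply, QRep.endAlg_one_apply,
      Finset.sum_eq_single k (fun j _ hj => hzero j k i hj.symm x hx) (by simp)]
    exact hid k i x hx

theorem CompleteOrthogonalIdempotents.isDecomp_range {ι : Type} [Fintype ι] {e : ι → V.endAlg}
    (he : CompleteOrthogonalIdempotents e) : IsDecomp fun j => Subrep.range (e j) := by
  refine ⟨fun i j => ?_, fun i => top_le_iff.1 fun x _ => ?_⟩
  · rw [Submodule.disjoint_def]
    intro x hx hx'
    have hker : (⨆ (k : ι) (_ : k ≠ j), (Subrep.range (e k)).S i) ≤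
        LinearMap.ker ((e j).1 i) := by
      refine iSup₂_le fun k hk => ?_
      rintro _ ⟨y, rfl⟩
      rw [LinearMap.mem_ker, ← QRep.endAlg_mul_apply, show e j * e k = 0 from he.ortho hk.symm]
      rfl
    rw [← (Subrep.isProj_range (he.idem j) i).map_id x hx]
    exact hker hx'
  · have hx : x = ∑ j, (e j).1 i x := by
      rw [← QRep.endAlg_sum_apply, he.complete, QRep.endAlg_one_apply]
    rw [hx]
    exact Submodule.sum_mem _ fun j _ => Submodule.mem_iSup_of_mem j ⟨x, rfl⟩

end Decomp

/-- For a connected, eventually outward, finitely branching tree quiver,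
every FLEI representation is a finite internal direct sum of indecomposable
subrepresentations, uniquely up to a bijection matching isomorphic summands; i.e. the
category of FLEI representations is Krull–Schmidt. -/
theorem stmt1 (F : Type) [Field F] (Q : Quiv)
    (htree : Q.IsTree) (hout : Q.EventuallyOutward) (hfb : Q.FinitelyBranching) :
    (∀ V : QRep F Q, V.IsFLEI →
      ∃ (n : ℕ) (W : Fin n → Subrep V), (∀ j, (W j).toRep.Indec) ∧ IsDecomp W) ∧
    (∀ V : QRep F Q, V.IsFLEI →
      ∀ (n m : ℕ) (W : Fin n → Subrep V) (X : Fin m → Subrep V),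
        (∀ j, (W j).toRep.Indec) → IsDecomp W →
        (∀ j, (X j).toRep.Indec) → IsDecomp X →
        ∃ e : Fin n ≃ Fin m, ∀ j, QRep.Iso (W j).toRep (X (e j)).toRep) := by
  refine ⟨fun V hV => ?_, fun V hV n m W X hW hWd hX hXd => ?_⟩
  · have := hV.finite_endAlg htree.1
    obtain ⟨ι, _, f, hf, hfp, hfs⟩ := exists_primitive_decomposition F (1 : V.endAlg) (one_mul 1)
    have hc : CompleteOrthogonalIdempotents (f ∘ (Fintype.equivFin ι).symm) :=
      CompleteOrthogonalIdempotents.equiv _ |>.2 ⟨hf, hfs⟩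
    exact ⟨Fintype.card ι, _,
      fun j => (Subrep.isProj_range (hc.idem j)).indec (hfp _), hc.isDecomp_range⟩
  · have := hV.finite_endAlg htree.1
    obtain ⟨e, he, heW⟩ := hWd.exists_idempotents
    obtain ⟨f, hf, hfX⟩ := hXd.exists_idempotents
    obtain ⟨σ, hσ⟩ := exists_equiv_idemEquiv_of_sum_eq F he.toOrthogonalIdempotents
      (fun j => (heW j).isPrimitiveIdem (hW j)) hf.toOrthogonalIdempotents
      (fun j => (hfX j).isPrimitiveIdem (hX j)) (he.complete.trans hf.complete.symm)
    exact ⟨σ, fun j => (heW j).iso (hfX _) (hσ j)⟩
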